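/- Let A ∈ ℂ with A ≠ 0, let N ≥ 1 be an integer, and let Φ be a real-valued C¹ function on a neighborhood U of 0 in ℂ of the form Φ(w) = Re(A·w^N) + R(w), where the remainder satisfies |R(w)| ≤ C·|w|^{N+1} and ‖∇R(w)‖ ≤ C·|w|^{N} on U for some constant C. Let θ₀ < θ₁ < … < θ_{2N−1} be the 2N angles in [θ₀, θ₀ + 2π) with Re(A·e^{i·N·θ_k}) = 0 (so θ_{k+1} − θ_k = π/N). Then there exists ε > 0 such that the punctured zero set { w : 0 < |w| < ε, Φ(w) = 0 } is the union of 2N pairwise disjoint arcs; more precisely, there are continuous injective curves γ_k : (0, ε] → ℂ, k = 0, …, 2N−1, with |γ_k(t)| = t, Φ(γ_k(t)) = 0 for all t, arg(γ_k(t)) → θ_k as t → 0⁺, and every w with 0 < |w| < ε and Φ(w) = 0 lies on exactly one of these curves. -/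

import Mathlib

open Real Filter Topology

/-- A quantitative form of the strict monotonicity of `sin` on `[-1, 1]`. -/
lemma abs_sub_div_four_le_abs_sin_sub_sin {x y : ℝ} (hx : |x| ≤ 1) (hy : |y| ≤ 1) :
    |x - y| / 4 ≤ |sin x - sin y| := by
  have hx' := abs_le.1 hx
  have hy' := abs_le.1 hy
  have hcos : 1 / 2 ≤ |cos ((x + y) / 2)| := by
    refine le_trans ?_ (le_abs_self _)
    have h := Real.one_sub_sq_div_two_le_cos (x := (x + y) / 2)
    have : ((x + y) / 2) ^ 2 ≤ 1 := by
      rw [sq_le_one_iff_abs_le_one, abs_le]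
      constructor <;> linarith
    linarith
  have hsin : |x - y| / 4 ≤ |sin ((x - y) / 2)| := by
    have h : |(x - y) / 2| ≤ π / 2 := by
      rw [abs_le]
      constructor <;> linarith [pi_gt_three]
    refine le_trans ?_ (Real.mul_abs_le_abs_sin h)
    have h2 : 1 / 2 ≤ 2 / π := by
      rw [div_le_div_iff₀ two_pos pi_pos]
      linarith [pi_le_four]
    have habs : |(x - y) / 2| = |x - y| / 2 := by
      rw [abs_div, abs_of_pos (two_pos : (0 : ℝ) < 2)]
    rw [habs]
    nlinarith [abs_nonneg (x - y)]
  rw [Real.sin_sub_sin, abs_mul, abs_mul, abs_of_pos (two_pos : (0 : ℝ) < 2)]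
  nlinarith [abs_nonneg (x - y), abs_nonneg (sin ((x - y) / 2))]

/-- Half of `|x|` is at most `|sin x|` for `|x| ≤ π / 2`. -/
lemma abs_le_two_mul_abs_sin {x : ℝ} (hx : |x| ≤ π / 2) : |x| ≤ 2 * |sin x| := by
  have h := Real.mul_abs_le_abs_sin hx
  have h2 : 1 / 2 ≤ 2 / π := by
    rw [div_le_div_iff₀ two_pos pi_pos]
    linarith [pi_le_four]
  nlinarith [abs_nonneg x]

/-- A small Lipschitz perturbation of `sin`, depending continuously on a parameter `t`, has a
unique zero in `[-π/2, π/2]`, which depends continuously on `t`. -/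
lemma exists_zero_sin_add_small {ρ : ℝ → ℝ → ℝ} {K ε : ℝ} (hKε : K * ε ≤ 1 / 8) (hK : 0 ≤ K)
    (hρ : ∀ t ∈ Set.Ioc 0 ε, ∀ x, |ρ t x| ≤ K * t)
    (hlip : ∀ t ∈ Set.Ioc 0 ε, ∀ x y, |ρ t x - ρ t y| ≤ K * t * |x - y|)
    (hcont : ∀ x, ContinuousOn (fun t => ρ t x) (Set.Ioc 0 ε)) :
    ∃ z : ℝ → ℝ, ContinuousOn z (Set.Ioc 0 ε) ∧
      ∀ t ∈ Set.Ioc 0 ε, |z t| ≤ 2 * (K * t) ∧ sin (z t) + ρ t (z t) = 0 ∧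
        ∀ y, |y| ≤ π / 2 → sin y + ρ t y = 0 → y = z t := by
  have hKt : ∀ t ∈ Set.Ioc 0 ε, K * t ≤ 1 / 8 := fun t ht =>
    (mul_le_mul_of_nonneg_left ht.2 hK).trans hKε
  have hsmall : ∀ t ∈ Set.Ioc 0 ε, ∀ y, |y| ≤ π / 2 → sin y + ρ t y = 0 → |y| ≤ 2 * (K * t) := by
    intro t ht y hy h0
    have h1 := abs_le_two_mul_abs_sin hy
    have h2 : |sin y| = |ρ t y| := by rw [eq_neg_of_add_eq_zero_left h0, abs_neg]
    linarith [hρ t ht y]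
  have hmono : ∀ t ∈ Set.Ioc 0 ε, ∀ x y, |x| ≤ 1 → |y| ≤ 1 →
      |x - y| / 8 ≤ |(sin x + ρ t x) - (sin y + ρ t y)| := by
    intro t ht x y hx hy
    have h1 := abs_sub_div_four_le_abs_sin_sub_sin hx hy
    have h2 := hlip t ht x y
    have h3 : |sin x - sin y| ≤ |(sin x + ρ t x) - (sin y + ρ t y)| + |ρ t x - ρ t y| := by
      have := abs_sub (sin x + ρ t x - (sin y + ρ t y)) (ρ t x - ρ t y)
      refine le_of_eq_of_le ?_ this
      congr 1
      ring
    nlinarith [hKt t ht, abs_nonneg (x - y)]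
  have hex : ∀ t ∈ Set.Ioc 0 ε, ∃ z, |z| ≤ 1 ∧ sin z + ρ t z = 0 := by
    intro t ht
    have hc : Continuous (ρ t) := by
      refine LipschitzWith.continuous (K := (K * t).toNNReal) (LipschitzWith.of_dist_le_mul ?_)
      intro x y
      rw [Real.coe_toNNReal _ (mul_nonneg hK ht.1.le)]
      exact hlip t ht x y
    have hs : 1 / 2 ≤ sin 1 := by
      have h1 := abs_le_two_mul_abs_sin (x := 1) (by rw [abs_one]; linarith [pi_gt_three])
      rw [abs_one, abs_of_pos (sin_pos_of_pos_of_lt_pi one_pos (by linarith [pi_gt_three]))] at h1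
      linarith
    have hb := hKt t ht
    have h1 := abs_le.1 (hρ t ht 1)
    have h2 := abs_le.1 (hρ t ht (-1))
    obtain ⟨z, hz, hz0⟩ := intermediate_value_Icc (a := (-1 : ℝ)) (b := 1) (by norm_num)
      (f := fun z => sin z + ρ t z) (continuous_sin.add hc).continuousOn
      (show (0 : ℝ) ∈ _ from ⟨by rw [sin_neg]; linarith, by linarith⟩)
    exact ⟨z, abs_le.2 hz, hz0⟩
  choose! z hz1 hz0 using hex
  have hz : ∀ t ∈ Set.Ioc 0 ε, |z t| ≤ 2 * (K * t) := fun t ht =>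
    hsmall t ht _ ((hz1 t ht).trans (by linarith [pi_gt_three])) (hz0 t ht)
  refine ⟨z, ?_, fun t ht => ⟨hz t ht, hz0 t ht, fun y hy hy0 => ?_⟩⟩
  · intro t₀ ht₀
    have hlim : Tendsto (fun t => 8 * |sin (z t₀) + ρ t (z t₀)|) (𝓝[Set.Ioc 0 ε] t₀) (𝓝 0) := by
      have h := (((hcont (z t₀) t₀ ht₀).tendsto.const_add (sin (z t₀))).abs).const_mul 8
      simpa only [hz0 t₀ ht₀, abs_zero, mul_zero] using h
    refine tendsto_iff_dist_tendsto_zero.2 (squeeze_zero' (Eventually.of_forall fun _ =>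
      dist_nonneg) ?_ hlim)
    filter_upwards [self_mem_nhdsWithin] with t ht
    have h := hmono t ht _ _ (hz1 t₀ ht₀) (hz1 t ht)
    rw [hz0 t ht, sub_zero] at h
    rw [Real.dist_eq, abs_sub_comm]
    linarith
  · have hy1 : |y| ≤ 1 := by linarith [hsmall t ht y hy hy0, hKt t ht]
    have h := hmono t ht _ _ hy1 (hz1 t ht)
    rw [hy0, hz0 t ht, sub_zero, abs_zero] at h
    exact sub_eq_zero.1 (abs_eq_zero.1 (le_antisymm (by linarith) (abs_nonneg _)))

/-- The zeros of a small Lipschitz perturbation of `sin` are continuous perturbations of the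
multiples of `π`. -/
lemma exists_zeros_sin_add_small {ρ : ℝ → ℝ → ℝ} {K ε : ℝ} (hKε : K * ε ≤ 1 / 8) (hK : 0 ≤ K)
    (hρ : ∀ t ∈ Set.Ioc 0 ε, ∀ x, |ρ t x| ≤ K * t)
    (hlip : ∀ t ∈ Set.Ioc 0 ε, ∀ x y, |ρ t x - ρ t y| ≤ K * t * |x - y|)
    (hcont : ∀ x, ContinuousOn (fun t => ρ t x) (Set.Ioc 0 ε)) :
    ∃ z : ℤ → ℝ → ℝ, (∀ k, ContinuousOn (z k) (Set.Ioc 0 ε)) ∧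
      (∀ k, ∀ t ∈ Set.Ioc 0 ε, |z k t| ≤ 2 * (K * t) ∧
        sin (k * π + z k t) + ρ t (k * π + z k t) = 0) ∧
      ∀ t ∈ Set.Ioc 0 ε, ∀ k : ℤ, ∀ y, |y| ≤ π / 2 →
        sin (k * π + y) + ρ t (k * π + y) = 0 → y = z k t := by
  have habs : ∀ k : ℤ, |((-1 : ℝ) ^ k)| = 1 := fun k => by
    rw [abs_zpow, abs_neg, abs_one, one_zpow]
  have hsin : ∀ (k : ℤ) (y a : ℝ), sin (k * π + y) + a = (-1) ^ k * (sin y + (-1) ^ k * a) := by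
    intro k y a
    rw [add_comm (k * π : ℝ) y, Real.sin_add_int_mul_pi, mul_add, ← mul_assoc,
      ← mul_zpow, neg_one_mul, neg_neg, one_zpow, one_mul]
  have key : ∀ k : ℤ, _ := fun k => exists_zero_sin_add_small
    (ρ := fun t x => (-1) ^ k * ρ t (k * π + x)) hKε hK
    (fun t ht x => by
      rw [abs_mul, habs, one_mul]
      exact hρ t ht _)
    (fun t ht x y => by
      rw [← mul_sub, abs_mul, habs, one_mul]
      simpa only [add_sub_add_left_eq_sub] using hlip t ht (k * π + x) (k * π + y))
    (fun x => continuousOn_const.mul (hcont _))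
  choose z hzc hz using key
  refine ⟨z, hzc, fun k t ht => ⟨(hz k t ht).1, ?_⟩, fun t ht k y hy h => (hz k t ht).2.2 y hy ?_⟩
  · rw [hsin, (hz k t ht).2.1, mul_zero]
  · rw [hsin] at h
    exact (mul_eq_zero.1 h).resolve_left (zpow_ne_zero _ (by norm_num))

/-- If `Re (A e^{iNθ₀}) = 0`, then `Re (A w^N)` is a multiple of `sin ψ` at the points of argument
`θ₀ + ψ / N`. -/
lemma exists_re_mul_pow_eq_sin {A : ℂ} (hA : A ≠ 0) {N : ℕ} (hN : N ≠ 0) {θ₀ : ℝ}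
    (hθ₀ : (A * Complex.exp (Complex.I * (N * θ₀))).re = 0) :
    ∃ s : ℝ, s ≠ 0 ∧ ∀ t ψ : ℝ,
      (A * (t * Complex.exp (Complex.I * ((θ₀ + ψ / N : ℝ) : ℂ))) ^ N).re = s * t ^ N * sin ψ := by
  set B := A * Complex.exp (Complex.I * (N * θ₀)) with hB
  have hN' : (N : ℂ) ≠ 0 := Nat.cast_ne_zero.2 hN
  refine ⟨-B.im, neg_ne_zero.2 fun h => ?_, fun t ψ => ?_⟩
  · exact mul_ne_zero hA (Complex.exp_ne_zero _) (Complex.ext hθ₀ h)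
  · have h : A * (t * Complex.exp (Complex.I * ((θ₀ + ψ / N : ℝ) : ℂ))) ^ N
        = ((t ^ N : ℝ) : ℂ) * (B * Complex.exp (ψ * Complex.I)) := by
      rw [mul_pow, ← Complex.exp_nat_mul, hB, mul_assoc A, ← Complex.exp_add]
      have : (N : ℂ) * (Complex.I * ((θ₀ + ψ / N : ℝ) : ℂ))
          = Complex.I * (N * θ₀) + ψ * Complex.I := by
        push_cast
        field_simp
      rw [this]
      push_cast
      ring
    rw [h, Complex.re_ofReal_mul, Complex.mul_re, hθ₀, Complex.exp_ofReal_mul_I_im]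
    ring

/-- A function with `‖∇R(w)‖ ≤ C |w|^N` is Lipschitz in the angular variable. -/
lemma abs_sub_circle_le {U : Set ℂ} {R : ℂ → ℝ} {C : ℝ} {N : ℕ} (hN : 1 ≤ N)
    (hRd : ∀ w ∈ U, DifferentiableAt ℝ R w)
    (hR' : ∀ w ∈ U, ‖fderiv ℝ R w‖ ≤ C * ‖w‖ ^ N) (θ₀ : ℝ) {t : ℝ} (ht : 0 ≤ t)
    (hU : ∀ w : ℂ, ‖w‖ = t → w ∈ U) (x y : ℝ) :
    |R (t * Complex.exp (Complex.I * ((θ₀ + x / N : ℝ) : ℂ)))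
      - R (t * Complex.exp (Complex.I * ((θ₀ + y / N : ℝ) : ℂ)))|
      ≤ C * t ^ (N + 1) * |x - y| := by
  have hnorm : ∀ a : ℝ, ‖(t : ℂ) * Complex.exp (Complex.I * (a : ℂ))‖ = t := fun a => by
    rw [norm_mul, mul_comm Complex.I, Complex.norm_exp_ofReal_mul_I, mul_one, Complex.norm_real,
      Real.norm_of_nonneg ht]
  have hcurve : ∀ x : ℝ, HasDerivAt
      (fun x : ℝ => (t : ℂ) * Complex.exp (Complex.I * ((θ₀ + x / N : ℝ) : ℂ)))
      (t * Complex.exp (Complex.I * ((θ₀ + x / N : ℝ) : ℂ)) * (Complex.I * ((1 / N : ℝ) : ℂ))) x := by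
    intro x
    have h := ((((hasDerivAt_id x).div_const (N : ℝ)).const_add θ₀).ofReal_comp.const_mul
      Complex.I).cexp.const_mul (t : ℂ)
    rw [← mul_assoc] at h
    exact h
  have hd : ∀ x : ℝ, HasDerivAt
      (fun x : ℝ => R (t * Complex.exp (Complex.I * ((θ₀ + x / N : ℝ) : ℂ)))) _ x := fun x =>
    (hRd _ (hU _ (hnorm (θ₀ + x / N)))).hasFDerivAt.comp_hasDerivAt x (hcurve x)
  refine Convex.norm_image_sub_le_of_norm_hasDerivWithin_le (s := Set.univ)
    (fun z _ => (hd z).hasDerivWithinAt) (fun z _ => ?_) convex_univ (Set.mem_univ y)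
    (Set.mem_univ x)
  refine (ContinuousLinearMap.le_opNorm _ _).trans ?_
  have h1 := hR' _ (hU _ (hnorm (θ₀ + z / N)))
  rw [norm_mul _ (Complex.I * _), norm_mul Complex.I, Complex.norm_I, one_mul, Complex.norm_real]
  rw [hnorm] at h1 ⊢
  have hN1 : ‖(1 / N : ℝ)‖ ≤ 1 := by
    rw [Real.norm_of_nonneg (by positivity)]
    exact div_le_one_of_le₀ (by exact_mod_cast hN) (by positivity)
  rw [pow_succ, ← mul_assoc C]
  exact mul_le_mul h1 (mul_le_of_le_one_right ht hN1) (by positivity) ((norm_nonneg _).trans h1)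

/-- Hartman–Wintner structure of the zero set near a true branch point: if
`Φ(w) = Re(A·w^N) + R(w)` on a neighborhood `U` of `0`, where `Φ` is `C¹`,
`|R(w)| ≤ C·|w|^{N+1}` and `‖∇R(w)‖ ≤ C·|w|^N`, then for some `ε > 0` the punctured zero
set `{0 < |w| < ε, Φ(w) = 0}` consists of `2N` disjoint arcs `γ_k`, parameterized by
modulus, leaving the origin in the directions `θ₀ + k·π/N`, `k = 0, …, 2N−1`, of the zeros
of `Re(A·e^{iNθ})`. -/
theorem hartman_wintner_zero_curves (A : ℂ) (hA : A ≠ 0) (N : ℕ) (hN : 1 ≤ N)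
    (U : Set ℂ) (hU : IsOpen U) (h0U : (0 : ℂ) ∈ U)
    (Φ : ℂ → ℝ) (R : ℂ → ℝ) (C : ℝ)
    (hΦC1 : ContDiffOn ℝ 1 Φ U)
    (hdecomp : ∀ w ∈ U, Φ w = (A * w ^ N).re + R w)
    (hR : ∀ w ∈ U, |R w| ≤ C * ‖w‖ ^ (N + 1))
    (hR' : ∀ w ∈ U, ‖fderiv ℝ R w‖ ≤ C * ‖w‖ ^ N)
    (θ₀ : ℝ) (hθ₀ : (A * Complex.exp (Complex.I * (N * θ₀))).re = 0) :
    ∃ ε > (0 : ℝ), ∃ γ : Fin (2 * N) → ℝ → ℂ,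
      (∀ k, ContinuousOn (γ k) (Set.Ioc 0 ε)) ∧
      (∀ k, Set.InjOn (γ k) (Set.Ioc 0 ε)) ∧
      (∀ k, ∀ t ∈ Set.Ioc (0 : ℝ) ε, ‖γ k t‖ = t ∧ Φ (γ k t) = 0) ∧
      (∀ k : Fin (2 * N), Tendsto (fun t : ℝ => γ k t / (t : ℂ)) (𝓝[>] 0)
        (𝓝 (Complex.exp (Complex.I * (θ₀ + (k : ℕ) * (π / N)))))) ∧
      (∀ w : ℂ, 0 < ‖w‖ → ‖w‖ < ε → Φ w = 0 →
        ∃! k : Fin (2 * N), ∃ t ∈ Set.Ioc (0 : ℝ) ε, γ k t = w) := by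
  have hN0 : N ≠ 0 := by omega
  have hNR : (N : ℝ) ≠ 0 := Nat.cast_ne_zero.2 hN0
  obtain ⟨s, hs, hre⟩ := exists_re_mul_pow_eq_sin hA hN0 hθ₀
  have hRd : ∀ w ∈ U, DifferentiableAt ℝ R w := by
    intro w hw
    have hΦd : DifferentiableAt ℝ Φ w :=
      (hΦC1.differentiableOn one_ne_zero).differentiableAt (hU.mem_nhds hw)
    have hpd : DifferentiableAt ℝ (fun w : ℂ => (A * w ^ N).re) w :=
      Complex.reCLM.differentiableAt.comp w
        (((differentiableAt_id (𝕜 := ℝ)).pow N).const_mul A)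
    refine (hΦd.sub hpd).congr_of_eventuallyEq ?_
    filter_upwards [hU.mem_nhds hw] with v hv
    simp [hdecomp v hv]
  set p : ℝ → ℝ → ℂ := fun t ψ => t * Complex.exp (Complex.I * ((θ₀ + ψ / N : ℝ) : ℂ)) with hp
  have hpn : ∀ t ψ, 0 ≤ t → ‖p t ψ‖ = t := fun t ψ ht => by
    rw [hp, norm_mul, mul_comm Complex.I, Complex.norm_exp_ofReal_mul_I, mul_one,
      Complex.norm_real, Real.norm_of_nonneg ht]
  obtain ⟨δ, hδ, hδU⟩ := Metric.isOpen_iff.1 hU 0 h0U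
  set K : ℝ := |C| / |s| with hKdef
  have hK : 0 ≤ K := by positivity
  obtain ⟨ε, hε, hεδ, hKε⟩ : ∃ ε > 0, ε < δ ∧ K * ε ≤ 1 / 8 := by
    refine ⟨min (δ / 2) (1 / (8 * (K + 1))), by positivity,
      (min_le_left _ _).trans_lt (by linarith), ?_⟩
    calc K * min (δ / 2) (1 / (8 * (K + 1))) ≤ (K + 1) * (1 / (8 * (K + 1))) := by
          gcongr
          · linarith
          · exact min_le_right _ _
      _ = 1 / 8 := by field_simp
  have hmem : ∀ t ∈ Set.Ioc 0 ε, ∀ w : ℂ, ‖w‖ = t → w ∈ U := fun t ht w hw =>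
    hδU (mem_ball_zero_iff.2 (by linarith [ht.2]))
  have hpU : ∀ t ∈ Set.Ioc 0 ε, ∀ ψ, p t ψ ∈ U := fun t ht ψ =>
    hmem t ht _ (hpn t ψ ht.1.le)
  have hΦp : ∀ t ∈ Set.Ioc 0 ε, ∀ ψ,
      Φ (p t ψ) = s * t ^ N * (sin ψ + R (p t ψ) / (s * t ^ N)) := by
    intro t ht ψ
    have : s * t ^ N ≠ 0 := mul_ne_zero hs (pow_pos ht.1 N).ne'
    rw [hdecomp _ (hpU t ht ψ), mul_add, mul_div_cancel₀ _ this, ← hre t ψ]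
  have hΦ0 : ∀ t ∈ Set.Ioc 0 ε, ∀ ψ,
      Φ (p t ψ) = 0 ↔ sin ψ + R (p t ψ) / (s * t ^ N) = 0 := by
    intro t ht ψ
    rw [hΦp t ht ψ, mul_eq_zero]
    exact or_iff_right (mul_ne_zero hs (pow_pos ht.1 N).ne')
  have hscale : ∀ t ∈ Set.Ioc 0 ε, ∀ a b : ℝ, |a| ≤ |C| * t ^ (N + 1) * b →
      |a / (s * t ^ N)| ≤ K * t * b := by
    intro t ht a b hab
    have htN := pow_pos ht.1 N
    have hs' := abs_pos.2 hs
    rw [abs_div, abs_mul, abs_of_pos htN, div_le_iff₀ (by positivity)]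
    refine hab.trans_eq ?_
    rw [hKdef]
    field_simp
    ring
  obtain ⟨z, hzc, hz, hzu⟩ := exists_zeros_sin_add_small
    (ρ := fun t ψ => R (p t ψ) / (s * t ^ N)) hKε hK
    (fun t ht x => by
      have h := hR _ (hpU t ht x)
      rw [hpn t x ht.1.le] at h
      have h2 : |R (p t x)| ≤ |C| * t ^ (N + 1) * 1 := by
        rw [mul_one]
        exact h.trans (mul_le_mul_of_nonneg_right (le_abs_self C) (pow_nonneg ht.1.le _))
      simpa only [mul_one] using hscale t ht _ _ h2)
    (fun t ht x y => by
      rw [← sub_div]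
      refine hscale t ht _ _ (abs_sub_circle_le hN hRd (fun w hw => ?_) θ₀ ht.1.le
        (hmem t ht) x y)
      exact (hR' w hw).trans
        (mul_le_mul_of_nonneg_right (le_abs_self C) (pow_nonneg (norm_nonneg _) _)))
    (fun x => by
      refine ContinuousOn.div ?_ (by fun_prop)
        (fun t ht => mul_ne_zero hs (pow_pos ht.1 N).ne')
      intro t ht
      have h1 : ContinuousAt (fun t => p t x) t := by
        simp only [hp]
        fun_prop
      exact ((hRd _ (hpU t ht x)).continuousAt.comp (f := fun t => p t x) h1).continuousWithinAt)
  have hzhalf : ∀ k, ∀ t ∈ Set.Ioc 0 ε, |z k t| ≤ 1 / 4 := fun k t ht => by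
    have := mul_le_mul_of_nonneg_left ht.2 hK
    linarith [(hz k t ht).1]
  refine ⟨ε, hε, fun k t => p t ((k : ℕ) * π + z (k : ℕ) t), fun k => ?_, fun k t ht t' ht' h => ?_,
    fun k t ht => ⟨hpn _ _ ht.1.le, ?_⟩, fun k => ?_, fun w hw0 hwε hw => ?_⟩
  · have := hzc (k : ℕ)
    simp only [hp]
    fun_prop
  · have h' := congrArg norm h
    simpa only [hpn _ _ ht.1.le, hpn _ _ ht'.1.le] using h'
  · rw [hΦ0 t ht]
    exact_mod_cast (hz (k : ℕ) t ht).2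
  · have hIoc : Set.Ioc 0 ε ∈ 𝓝[>] (0 : ℝ) := Ioc_mem_nhdsGT hε
    have hz0 : Tendsto (z (k : ℕ)) (𝓝[>] 0) (𝓝 0) := by
      refine squeeze_zero_norm' (a := fun t => 2 * (K * t)) ?_ ?_
      · filter_upwards [hIoc] with t ht using (hz _ t ht).1
      · have : Tendsto (fun t : ℝ => 2 * (K * t)) (𝓝 0) (𝓝 (2 * (K * 0))) :=
          Continuous.tendsto (by fun_prop) 0
        simp only [mul_zero] at this
        exact this.mono_left nhdsWithin_le_nhds
    have hcont : Continuous fun x : ℝ =>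
        Complex.exp (Complex.I * ((θ₀ + ((k : ℕ) * π + x) / N : ℝ) : ℂ)) := by fun_prop
    have hlim := (hcont.tendsto 0).comp hz0
    have hval : Complex.exp (Complex.I * ((θ₀ + ((k : ℕ) * π + 0) / N : ℝ) : ℂ))
        = Complex.exp (Complex.I * (θ₀ + (k : ℕ) * (π / N))) := by
      congr 2
      push_cast
      ring
    rw [hval] at hlim
    refine hlim.congr' ?_
    filter_upwards [hIoc] with t ht
    have : (t : ℂ) ≠ 0 := Complex.ofReal_ne_zero.2 ht.1.ne'
    simp only [hp, Function.comp]
    rw [mul_div_cancel_left₀ _ this]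
  · have ht : ‖w‖ ∈ Set.Ioc 0 ε := ⟨hw0, hwε.le⟩
    have hperiod : ∀ (t ψ : ℝ) (m : ℤ), p t (ψ + 2 * N * m * π) = p t ψ := by
      intro t ψ m
      simp only [hp]
      congr 1
      rw [Complex.exp_eq_exp_iff_exists_int]
      refine ⟨m, ?_⟩
      push_cast
      field_simp
      ring
    have hinj : ∀ (t ψ ψ' : ℝ), t ≠ 0 → p t ψ = p t ψ' → ∃ m : ℤ, ψ = ψ' + 2 * N * m * π := by
      intro t ψ ψ' ht h
      have h1 := mul_left_cancel₀ (Complex.ofReal_ne_zero.2 ht) h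
      obtain ⟨m, hm⟩ := Complex.exp_eq_exp_iff_exists_int.1 h1
      refine ⟨m, ?_⟩
      have h2 : ((θ₀ + ψ / N : ℝ) : ℂ) = ((θ₀ + ψ' / N + m * (2 * π) : ℝ) : ℂ) := by
        apply mul_left_cancel₀ Complex.I_ne_zero
        rw [hm]
        push_cast
        ring
      have h3 := Complex.ofReal_injective h2
      field_simp at h3
      linarith
    obtain ⟨ψ, hψ⟩ : ∃ ψ, p ‖w‖ ψ = w := by
      refine ⟨N * (Complex.arg w - θ₀), ?_⟩
      have h := Complex.norm_mul_exp_arg_mul_I w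
      simp only [hp]
      rw [mul_div_cancel_left₀ _ hNR, add_sub_cancel, mul_comm Complex.I]
      exact h
    obtain ⟨k, m, hk⟩ : ∃ (k : Fin (2 * N)) (m : ℤ), round (ψ / π) = (k : ℕ) + 2 * N * m := by
      have hpos : (0 : ℤ) < 2 * N := by omega
      have h1 := Int.emod_nonneg (round (ψ / π)) hpos.ne'
      have h2 := Int.emod_lt_of_pos (round (ψ / π)) hpos
      refine ⟨⟨(round (ψ / π) % (2 * N)).toNat, by omega⟩, round (ψ / π) / (2 * N), ?_⟩
      rw [Int.toNat_of_nonneg h1]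
      exact (Int.emod_add_mul_ediv _ _).symm
    have hround : |ψ - (round (ψ / π) : ℝ) * π| ≤ π / 2 := by
      have h := abs_sub_round (ψ / π)
      have h2 : ψ - (round (ψ / π) : ℝ) * π = (ψ / π - round (ψ / π)) * π := by
        field_simp
      rw [h2, abs_mul, abs_of_pos pi_pos]
      linarith [mul_le_mul_of_nonneg_right h pi_pos.le]
    have hkR : (round (ψ / π) : ℝ) = (k : ℕ) + 2 * N * m := by
      rw [hk]
      push_cast
      ring
    set y := ψ - (round (ψ / π) : ℝ) * π with hy
    have hpy : p ‖w‖ ((k : ℕ) * π + y) = w := by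
      have hsum : ((k : ℕ) * π + y) + 2 * N * m * π = ψ := by
        rw [hy, hkR]
        ring
      rw [← hperiod _ _ m, hsum, hψ]
    have hyz : y = z (k : ℕ) ‖w‖ := by
      refine hzu _ ht _ _ hround ?_
      rw [← hΦ0 _ ht]
      push_cast
      rw [hpy, hw]
    refine ⟨k, ⟨‖w‖, ht, by simp only [← hyz, hpy]⟩, ?_⟩
    rintro j ⟨t, htε, hj⟩
    have htw : t = ‖w‖ := by rw [← hj, hpn _ _ htε.1.le]
    subst htw
    obtain ⟨n, hn⟩ := hinj _ _ _ hw0.ne' (hj.trans hpy.symm)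
    rw [hyz] at hn
    have hzj := abs_le.1 (hzhalf (j : ℕ) _ ht)
    have hzk := abs_le.1 (hzhalf (k : ℕ) _ ht)
    have hint : |(((j : ℕ) - (k : ℕ) - 2 * N * n : ℤ) : ℝ)| < 1 := by
      have h1 : (((j : ℕ) - (k : ℕ) - 2 * N * n : ℤ) : ℝ) * π
          = z (k : ℕ) ‖w‖ - z (j : ℕ) ‖w‖ := by
        push_cast
        linarith
      have h2 : |(((j : ℕ) - (k : ℕ) - 2 * N * n : ℤ) : ℝ)| * π ≤ 1 := by
        rw [← abs_of_pos pi_pos, ← abs_mul, h1, abs_le]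
        constructor <;> linarith
      nlinarith [pi_gt_three, abs_nonneg (((j : ℕ) - (k : ℕ) - 2 * N * n : ℤ) : ℝ)]
    have hzero : ((j : ℕ) - (k : ℕ) - 2 * N * n : ℤ) = 0 := by
      rw [← Int.abs_lt_one_iff]
      exact_mod_cast hint
    have hj2 := j.2
    have hk2 := k.2
    have hn0 : n = 0 := by
      rw [← Int.abs_lt_one_iff, abs_lt]
      constructor <;> nlinarith
    subst hn0
    ext
    omega
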